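/- arXiv:1304.8089 — 2 statements merged into one kernel-verified Lean document; each statement's English description precedes it below -/
import Mathlib

section
/- In the single-variable DSD fitting problem, assume S_c + S_r > 0. If (α*, β*, γ*) is a global minimizer of f over the feasible region {α ≥ 0, β ≥ 0, γ ∈ ℝ} with α* = 0 and β* > 0, then β* = (S_{rr} − S_{cc})/(S_c + S_r) and γ* = Ȳ + β* X̄. -/
/-- The deviations from the arithmetic mean sum to zero. -/
lemma sum_sub_mean_eq_zero {m : ℕ} (hm : 1 ≤ m) (x : Fin m → ℝ) {xbar : ℝ}
    (hx : xbar = (1 / (m : ℝ)) * ∑ j, x j) : ∑ j, (x j - xbar) = 0 := by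
  have hm' : (m : ℝ) ≠ 0 := by positivity
  rw [Finset.sum_sub_distrib, hx]
  simp [hm']

/-- The objective on the face `α = 0`, with the intercept decoupled from the slope. -/
lemma sum_sq_face_eq {m : ℕ} (cX rX cY rY : Fin m → ℝ) {Xbar Ybar : ℝ}
    (hX : ∑ j, (cX j - Xbar) = 0) (hY : ∑ j, (cY j - Ybar) = 0) (b g : ℝ) :
    ∑ j, ((cY j - (0 - b) * cX j - g) ^ 2 + (1 / 3) * (rY j - (0 + b) * rX j) ^ 2) =
      ∑ j, ((cY j - Ybar) ^ 2 + (1 / 3) * rY j ^ 2) + m * (Ybar + b * Xbar - g) ^ 2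
        + (∑ j, (cX j - Xbar) ^ 2 + (1 / 3) * ∑ j, rX j ^ 2) * b ^ 2
        - 2 * b * ((1 / 3) * ∑ j, rX j * rY j
          - ∑ j, (cY j - Ybar) * (cX j - Xbar)) := by
  have hterm : ∀ j, (cY j - (0 - b) * cX j - g) ^ 2 + (1 / 3) * (rY j - (0 + b) * rX j) ^ 2 =
      ((cY j - Ybar) ^ 2 + (1 / 3) * rY j ^ 2) + (Ybar + b * Xbar - g) ^ 2
        + b ^ 2 * (cX j - Xbar) ^ 2 + (b ^ 2 / 3) * rX j ^ 2
        - (2 * b / 3) * (rX j * rY j) + (2 * b) * ((cY j - Ybar) * (cX j - Xbar))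
        + (2 * (Ybar + b * Xbar - g)) * (cY j - Ybar)
        + (2 * b * (Ybar + b * Xbar - g)) * (cX j - Xbar) := fun j => by ring
  rw [Finset.sum_congr rfl fun j _ => hterm j, Finset.sum_add_distrib, Finset.sum_add_distrib,
    Finset.sum_add_distrib, Finset.sum_sub_distrib, Finset.sum_add_distrib,
    Finset.sum_add_distrib, Finset.sum_add_distrib (g := fun _ => (Ybar + b * Xbar - g) ^ 2)]
  simp only [← Finset.mul_sum, hX, hY, Finset.sum_const, Finset.card_univ, Fintype.card_fin,
    nsmul_eq_mul]
  ring

/-- A positive minimizer over `[0, ∞)` of a strictly convex quadratic is its vertex. -/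
lemma eq_vertex_of_forall_nonneg_le {A D β : ℝ} (hA : 0 < A) (hβ : 0 < β)
    (hmin : ∀ b, 0 ≤ b → A * β ^ 2 - 2 * β * D ≤ A * b ^ 2 - 2 * b * D) : β = D / A := by
  have hD : 0 ≤ D := by
    by_contra! hD
    nlinarith [hmin 0 le_rfl, mul_pos hβ (neg_pos.mpr hD), mul_pos hA (pow_pos hβ 2)]
  have h := hmin (D / A) (by positivity)
  have hDA : A * (D / A) = D := by field_simp
  have hsq : A * (β - D / A) ^ 2 ≤ 0 := by
    calc A * (β - D / A) ^ 2
        = (A * β ^ 2 - 2 * β * (A * (D / A)))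
            - (A * (D / A) ^ 2 - 2 * (D / A) * (A * (D / A))) := by ring
      _ ≤ 0 := by rw [hDA]; linarith
  have hzero : (β - D / A) ^ 2 = 0 :=
    le_antisymm (nonpos_of_mul_nonpos_right hsq hA) (sq_nonneg _)
  exact sub_eq_zero.mp (pow_eq_zero_iff two_ne_zero |>.mp hzero)

/-- Single-variable DSD fitting: if `S_c + S_r > 0` and `(α*, β*, γ*)` is a
global minimizer of `f` over `{α ≥ 0, β ≥ 0, γ ∈ ℝ}` with `α* = 0` and
`β* > 0`, then `β* = (S_rr − S_cc)/(S_c + S_r)` and `γ* = Ȳ + β* X̄`. -/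
theorem dsd_single_minimizer_alpha_zero (m : ℕ) (hm : 1 ≤ m)
    (cX rX cY rY : Fin m → ℝ) (hrX : ∀ j, 0 ≤ rX j) (hrY : ∀ j, 0 ≤ rY j)
    (f : ℝ → ℝ → ℝ → ℝ)
    (hf : f = fun a b g => ∑ j, ((cY j - (a - b) * cX j - g) ^ 2
        + (1 / 3) * (rY j - (a + b) * rX j) ^ 2))
    (Xbar Ybar Sc Sr Scc Srr : ℝ)
    (hXbar : Xbar = (1 / (m : ℝ)) * ∑ j, cX j)
    (hYbar : Ybar = (1 / (m : ℝ)) * ∑ j, cY j)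
    (hSc : Sc = ∑ j, (cX j - Xbar) ^ 2)
    (hSr : Sr = (1 / 3) * ∑ j, (rX j) ^ 2)
    (hScc : Scc = ∑ j, (cY j - Ybar) * (cX j - Xbar))
    (hSrr : Srr = (1 / 3) * ∑ j, rX j * rY j)
    (hpos : 0 < Sc + Sr)
    (α β γ : ℝ) (hα : α = 0) (hβ : 0 < β)
    (hmin : ∀ a b g : ℝ, 0 ≤ a → 0 ≤ b → f α β γ ≤ f a b g) :
    β = (Srr - Scc) / (Sc + Sr) ∧ γ = Ybar + β * Xbar := by
  have hface : ∀ b g, f 0 b g = ∑ j, ((cY j - Ybar) ^ 2 + (1 / 3) * rY j ^ 2)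
      + m * (Ybar + b * Xbar - g) ^ 2 + (Sc + Sr) * b ^ 2 - 2 * b * (Srr - Scc) := by
    intro b g
    rw [hf, hSc, hSr, hScc, hSrr]
    exact sum_sq_face_eq cX rX cY rY (sum_sub_mean_eq_zero hm cX hXbar)
      (sum_sub_mean_eq_zero hm cY hYbar) b g
  subst hα
  have hm' : (0 : ℝ) < m := by positivity
  constructor
  · refine eq_vertex_of_forall_nonneg_le hpos hβ fun b hb => ?_
    have h := hmin 0 b (Ybar + b * Xbar) le_rfl hb
    rw [hface, hface, sub_self] at h
    nlinarith [mul_nonneg hm'.le (sq_nonneg (Ybar + β * Xbar - γ))]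
  · have h := hmin 0 β (Ybar + β * Xbar) le_rfl hβ.le
    rw [hface, hface, sub_self] at h
    have hsq : (m : ℝ) * (Ybar + β * Xbar - γ) ^ 2 ≤ 0 := by linarith
    have hzero : (Ybar + β * Xbar - γ) ^ 2 = 0 :=
      le_antisymm (nonpos_of_mul_nonpos_right hsq hm') (sq_nonneg _)
    exact (sub_eq_zero.mp (pow_eq_zero_iff two_ne_zero |>.mp hzero)).symm
end

section
/- Let (α*, β*, γ*) be a global minimizer of the DSD objective F over the feasible region {(α, β, γ) : α_k ≥ 0, β_k ≥ 0 for all k, γ ∈ ℝ}, with m ≥ 1, and let Ψ_Ŷ(j) be the corresponding predicted quantile functions. If Σ_{j=1}^m D_M²(Ψ_{Y(j)}, Ψ̄) > 0, where Ψ̄ is the constant function with value Ȳ = (1/m)Σ_j c_{Y(j)}, then the goodness-of-fit measure Ω = [Σ_{j=1}^m D_M²(Ψ_Ŷ(j), Ψ̄)] / [Σ_{j=1}^m D_M²(Ψ_{Y(j)}, Ψ̄)] satisfies 0 ≤ Ω ≤ 1. -/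
/-- The squared `L²([0,1])` norm of the quantile function with centre `a` and half-range `b`. -/
lemma integral_sq_center_add_halfRange (a b : ℝ) :
    ∫ t in (0:ℝ)..1, (a + b * (2 * t - 1)) ^ 2 = a ^ 2 + b ^ 2 / 3 := by
  have h : ∀ t ∈ Set.uIcc (0:ℝ) 1,
      HasDerivAt (fun t : ℝ => (a - b) ^ 2 * t + 2 * (a - b) * b * t ^ 2 + 4 / 3 * b ^ 2 * t ^ 3)
        ((a + b * (2 * t - 1)) ^ 2) t := by
    intro t _
    have h := (((hasDerivAt_id' t).const_mul ((a - b) ^ 2)).add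
      ((hasDerivAt_pow 2 t).const_mul (2 * (a - b) * b))).add
      ((hasDerivAt_pow 3 t).const_mul (4 / 3 * b ^ 2))
    refine HasDerivAt.congr_deriv h ?_
    push_cast
    ring
  rw [intervalIntegral.integral_eq_sub_of_hasDerivAt h
    (Continuous.intervalIntegrable (by fun_prop) _ _)]
  ring

/-- If `s ↦ C s² - 2 B s` is minimized over `s ≥ 0` at `s = 1`, then `C ≤ B`. -/
lemma le_of_quadratic_min_at_one {B C : ℝ}
    (h : ∀ s : ℝ, 0 ≤ s → C - 2 * B ≤ s ^ 2 * C - 2 * s * B) : C ≤ B := by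
  by_contra! hlt
  have h0 := h 0 le_rfl
  have hB : 0 ≤ B := by linarith
  have hCpos : 0 < C := by linarith
  have hs := h (B / C) (by positivity)
  have he : (B / C) ^ 2 * C - 2 * (B / C) * B = -(B ^ 2 / C) := by
    field_simp
    ring
  have hdiv : B ^ 2 / C ≤ 2 * B - C := by linarith
  rw [div_le_iff₀ hCpos] at hdiv
  nlinarith [mul_pos (sub_pos.2 hlt) (sub_pos.2 hlt)]

/-- At a global minimizer `(α*, β*, γ*)` of the DSD objective
`F(α,β,γ) = Σ_j D_M²(Ψ_{Y(j)}, Ψ_Ŷ(j))` over `{α_k ≥ 0, β_k ≥ 0, γ ∈ ℝ}`, if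
`Σ_j D_M²(Ψ_{Y(j)}, Ψ̄) > 0` then the goodness-of-fit measure
`Ω = Σ_j D_M²(Ψ_Ŷ(j), Ψ̄) / Σ_j D_M²(Ψ_{Y(j)}, Ψ̄)` satisfies `0 ≤ Ω ≤ 1`. -/
theorem dsd_goodness_of_fit_between_zero_one (m p : ℕ) (hm : 1 ≤ m)
    (c r : Fin p → Fin m → ℝ) (hr : ∀ k j, 0 ≤ r k j)
    (cY rY : Fin m → ℝ) (hrY : ∀ j, 0 ≤ rY j)
    (F : (Fin p → ℝ) → (Fin p → ℝ) → ℝ → ℝ)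
    (hF : F = fun α β γ => ∑ j, ∫ t in (0:ℝ)..1,
        ((cY j + rY j * (2 * t - 1))
          - ((∑ k, (α k - β k) * c k j) + γ
              + (∑ k, (α k + β k) * r k j) * (2 * t - 1))) ^ 2)
    (α β : Fin p → ℝ) (γ : ℝ) (hα : ∀ k, 0 ≤ α k) (hβ : ∀ k, 0 ≤ β k)
    (hmin : ∀ (a b : Fin p → ℝ) (g : ℝ), (∀ k, 0 ≤ a k) → (∀ k, 0 ≤ b k) →
      F α β γ ≤ F a b g)
    (Ybar : ℝ) (hYbar : Ybar = (1 / (m : ℝ)) * ∑ j, cY j)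
    (hden : 0 < ∑ j, ∫ t in (0:ℝ)..1, ((cY j + rY j * (2 * t - 1)) - Ybar) ^ 2) :
    0 ≤ (∑ j, ∫ t in (0:ℝ)..1,
            (((∑ k, (α k - β k) * c k j) + γ
                + (∑ k, (α k + β k) * r k j) * (2 * t - 1)) - Ybar) ^ 2)
          / (∑ j, ∫ t in (0:ℝ)..1, ((cY j + rY j * (2 * t - 1)) - Ybar) ^ 2)
    ∧ (∑ j, ∫ t in (0:ℝ)..1,
            (((∑ k, (α k - β k) * c k j) + γ
                + (∑ k, (α k + β k) * r k j) * (2 * t - 1)) - Ybar) ^ 2)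
          / (∑ j, ∫ t in (0:ℝ)..1, ((cY j + rY j * (2 * t - 1)) - Ybar) ^ 2)
        ≤ 1 := by
  set P : Fin m → ℝ := fun j => ∑ k, (α k - β k) * c k j
  set R : Fin m → ℝ := fun j => ∑ k, (α k + β k) * r k j
  have hnum : (∑ j, ∫ t in (0:ℝ)..1, ((P j + γ + R j * (2 * t - 1)) - Ybar) ^ 2)
      = ∑ j, ((P j + γ - Ybar) ^ 2 + R j ^ 2 / 3) := by
    refine Finset.sum_congr rfl fun j _ => ?_
    rw [← integral_sq_center_add_halfRange]
    congr! 3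
    ring
  have hden_eq : (∑ j, ∫ t in (0:ℝ)..1, ((cY j + rY j * (2 * t - 1)) - Ybar) ^ 2)
      = ∑ j, ((cY j - Ybar) ^ 2 + rY j ^ 2 / 3) := by
    refine Finset.sum_congr rfl fun j _ => ?_
    rw [← integral_sq_center_add_halfRange]
    congr! 3
    ring
  have hscale : ∀ s : ℝ,
      F (fun k => s * α k) (fun k => s * β k) (s * γ + (1 - s) * Ybar)
        = ∑ j, ((cY j - Ybar - s * (P j + γ - Ybar)) ^ 2 + (rY j - s * R j) ^ 2 / 3) := by
    intro s
    rw [hF]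
    refine Finset.sum_congr rfl fun j _ => ?_
    have hP : ∑ k, (s * α k - s * β k) * c k j = s * P j := by
      simp only [P, Finset.mul_sum]
      exact Finset.sum_congr rfl fun k _ => by ring
    have hR : ∑ k, (s * α k + s * β k) * r k j = s * R j := by
      simp only [R, Finset.mul_sum]
      exact Finset.sum_congr rfl fun k _ => by ring
    rw [← integral_sq_center_add_halfRange, hP, hR]
    congr! 3
    ring
  rw [hnum]
  rw [hden_eq] at hden ⊢
  set A := ∑ j, ((cY j - Ybar) ^ 2 + rY j ^ 2 / 3) with hA
  set C := ∑ j, ((P j + γ - Ybar) ^ 2 + R j ^ 2 / 3) with hCdef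
  set B := ∑ j, ((cY j - Ybar) * (P j + γ - Ybar) + rY j * R j / 3) with hB
  have hC : 0 ≤ C := Finset.sum_nonneg fun j _ => by positivity
  have hquad : ∀ s : ℝ,
      ∑ j, ((cY j - Ybar - s * (P j + γ - Ybar)) ^ 2 + (rY j - s * R j) ^ 2 / 3)
        = A - 2 * s * B + s ^ 2 * C := by
    intro s
    rw [hA, hB, hCdef, Finset.mul_sum, Finset.mul_sum, ← Finset.sum_sub_distrib,
      ← Finset.sum_add_distrib]
    exact Finset.sum_congr rfl fun j _ => by ring
  have hFone : F α β γ = A - 2 * B + C := by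
    have h := (hscale 1).trans (hquad 1)
    simpa using h
  have hCB : C ≤ B := le_of_quadratic_min_at_one fun s hs => by
    have h := hmin (fun k => s * α k) (fun k => s * β k) (s * γ + (1 - s) * Ybar)
      (fun k => mul_nonneg hs (hα k)) (fun k => mul_nonneg hs (hβ k))
    rw [hscale, hquad, hFone] at h
    linarith
  have hres : 0 ≤ A - 2 * 1 * B + 1 ^ 2 * C := by
    rw [← hquad 1]
    exact Finset.sum_nonneg fun j _ => by positivity
  exact ⟨by positivity, (div_le_one hden).2 (by linarith)⟩
end
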